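/- For every natural number n ≥ 1, ∫₀⁴ xⁿ · √(4x−x²)/(4πx) dx = C(2n,n)/(2(n+1)); equivalently, for every real z with 0 < |z| < 1/4, (1 + 2z − √(1−4z))/(4z) = 1 + Σ_{n≥1} C(2n,n)/(2(n+1)) · zⁿ. -/

import Mathlib

open MeasureTheory

lemma W_val (n : ℕ) : ∫ x in (0:ℝ)..(Real.pi/2), Real.sin x ^ (2*n)
    = Real.pi / 2 * (Nat.centralBinom n : ℝ) / 4 ^ n := by
  induction n with
  | zero => simp
  | succ n ih =>
    rw [show 2 * (n+1) = 2*n + 2 by ring, integral_sin_pow, ih]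
    have h : ((n:ℝ)+1) * Nat.centralBinom (n+1) = 2 * (2*n+1) * Nat.centralBinom n := by
      exact_mod_cast Nat.succ_mul_centralBinom_succ n
    have h2 : (Nat.centralBinom (n+1) : ℝ) = 2 * (2*n+1) * Nat.centralBinom n / ((n:ℝ)+1) := by
      rw [← h]; field_simp
    rw [h2]
    simp only [Real.sin_zero, Real.cos_pi_div_two]
    push_cast
    rw [pow_succ (4:ℝ)]
    field_simp
    simp
    try ring

lemma coef (n : ℕ) : Ring.choose (1/2 : ℝ) (n+1) * (-4)^(n+1)
    = - 2 * (Nat.centralBinom n : ℝ) / (n+1) := by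
  induction n with
  | zero => norm_num [Ring.choose_one_right]
  | succ n ih =>
    have h : ((n:ℝ)+1) * Nat.centralBinom (n+1) = 2 * (2*n+1) * Nat.centralBinom n := by
      exact_mod_cast Nat.succ_mul_centralBinom_succ n
    have h2 : (Nat.centralBinom (n+1) : ℝ) = 2 * (2*n+1) * Nat.centralBinom n / ((n:ℝ)+1) := by
      rw [← h]; field_simp
    have h3 := Ring.choose_smul_choose (1/2 : ℝ) (Nat.le_succ (n+1))
    simp only [Nat.succ_eq_add_one, Nat.add_sub_cancel_left, Ring.choose_one_right,
      Nat.choose_succ_self_right, nsmul_eq_mul] at h3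
    push_cast at h3
    have h4 : Ring.choose (1/2 : ℝ) (n+1+1)
        = Ring.choose (1/2 : ℝ) (n+1) * (1/2 - (n+1)) / (n+1+1) := by
      rw [← h3]; field_simp
    have h5 : Ring.choose (1/2 : ℝ) (n+1+1) * (-4)^(n+1+1)
      = (Ring.choose (1/2 : ℝ) (n+1) * (-4)^(n+1)) * ((1/2 - (n+1)) / (n+1+1) * (-4)) := by
      rw [h4]; ring
    rw [h5, ih, h2]
    push_cast
    field_simp
    ring

lemma part1 (m : ℕ) :
    ∫ x in Set.Ioo (0 : ℝ) 4, x ^ (m+1) * (Real.sqrt (4 * x - x ^ 2) / (4 * Real.pi * x))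
        = (Nat.centralBinom (m+1) : ℝ) / (2 * (((m+1 : ℕ) : ℝ) + 1)) := by
  have e1 : ∫ x in Set.Ioo (0 : ℝ) 4, x ^ (m+1) * (Real.sqrt (4 * x - x ^ 2) / (4 * Real.pi * x))
      = ∫ x in (0:ℝ)..4, x ^ m * Real.sqrt (4 * x - x ^ 2) / (4 * Real.pi) := by
    rw [intervalIntegral.integral_of_le (by norm_num), integral_Ioc_eq_integral_Ioo]
    refine setIntegral_congr_fun measurableSet_Ioo fun x hx => ?_
    have := hx.1.ne'
    have := Real.pi_ne_zero
    field_simp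
    ring
  have e2 := intervalIntegral.integral_comp_mul_deriv (a := 0) (b := Real.pi/2)
    (f := fun t => 4 * Real.sin t ^ 2) (f' := fun t => 8 * Real.sin t * Real.cos t)
    (g := fun x => x ^ m * Real.sqrt (4 * x - x ^ 2) / (4 * Real.pi))
    (fun t _ => by
      have := ((Real.hasDerivAt_sin t).pow 2).const_mul 4
      refine HasDerivAt.congr_deriv this ?_
      simp
      ring) (by fun_prop) (by fun_prop)
  simp only [Real.sin_zero, Real.sin_pi_div_two, one_pow, mul_one,
    show (4:ℝ) * 0 ^ 2 = 0 by norm_num] at e2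
  rw [e1, ← e2]
  have e3 : ∫ t in (0:ℝ)..(Real.pi/2), ((fun x => x ^ m * Real.sqrt (4 * x - x ^ 2) / (4 * Real.pi))
        ∘ fun t => 4 * Real.sin t ^ 2) t * (8 * Real.sin t * Real.cos t)
      = ∫ t in (0:ℝ)..(Real.pi/2), (2 * 4^(m+1) / Real.pi) *
        (Real.sin t ^ (2*(m+1)) - Real.sin t ^ (2*(m+1+1))) := by
    refine intervalIntegral.integral_congr fun t ht => ?_
    rw [Set.uIcc_of_le (by positivity)] at ht
    have hs : 0 ≤ Real.sin t := Real.sin_nonneg_of_nonneg_of_le_pi ht.1 (by linarith [ht.2, Real.pi_pos])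
    have hc : 0 ≤ Real.cos t := Real.cos_nonneg_of_neg_pi_div_two_le_of_le (by linarith [ht.1, Real.pi_pos]) ht.2
    have hq : Real.sqrt (4 * (4 * Real.sin t ^ 2) - (4 * Real.sin t ^ 2)^2)
        = 4 * Real.sin t * Real.cos t := by
      rw [← Real.sqrt_sq (by positivity : 0 ≤ 4 * Real.sin t * Real.cos t)]
      congr 1
      have := Real.sin_sq_add_cos_sq t
      rw [mul_pow _ (Real.cos t), Real.cos_sq']
      ring
    have := Real.pi_ne_zero
    simp only [Function.comp]
    rw [hq, show (4 * Real.sin t ^ 2) ^ m * (4 * Real.sin t * Real.cos t) / (4 * Real.pi) *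
      (8 * Real.sin t * Real.cos t) = (4 * Real.sin t ^ 2) ^ m * (4 * Real.sin t) / (4 * Real.pi) *
      (8 * Real.sin t) * Real.cos t ^ 2 by ring, Real.cos_sq', mul_pow, ← pow_mul]
    field_simp
    ring
  simp only [Function.comp_def] at e3 ⊢
  rw [e3, intervalIntegral.integral_const_mul, intervalIntegral.integral_sub
    (Continuous.intervalIntegrable (by fun_prop) _ _)
    (Continuous.intervalIntegrable (by fun_prop) _ _), W_val, W_val]
  have h : (((m+1:ℕ):ℝ)+1) * Nat.centralBinom (m+1+1) = 2 * (2*((m+1:ℕ):ℝ)+1) * Nat.centralBinom (m+1) := by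
    exact_mod_cast Nat.succ_mul_centralBinom_succ (m+1)
  have h2 : (Nat.centralBinom (m+1+1) : ℝ) = 2 * (2*((m+1:ℕ):ℝ)+1) * Nat.centralBinom (m+1) / (((m+1:ℕ):ℝ)+1) := by
    rw [← h]; field_simp
  rw [h2]
  have := Real.pi_ne_zero
  push_cast
  field_simp
  ring

lemma part2 (z : ℝ) (h0 : 0 < |z|) (h1 : |z| < 1/4) : HasSum
        (fun n : ℕ =>
          (Nat.centralBinom (n + 1) : ℝ) / (2 * ((n : ℝ) + 2)) * z ^ (n + 1))
        ((1 + 2 * z - Real.sqrt (1 - 4 * z)) / (4 * z) - 1) := by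
  have hz : z ≠ 0 := abs_pos.mp h0
  have key := (Real.one_add_rpow_hasFPowerSeriesOnBall_zero (a := 1/2)).hasSum (y := -4*z) (by
    simp only [Metric.mem_eball, edist_zero_right]
    rw [← ofReal_norm, ENNReal.ofReal_lt_one, Real.norm_eq_abs, abs_mul]
    norm_num; linarith)
  simp only [binomialSeries_apply, List.ofFn_const, List.prod_replicate, smul_eq_mul, zero_add,
    ← Real.sqrt_eq_rpow] at key
  have k2 := (hasSum_nat_add_iff' 2).mpr key
  have k3 := k2.mul_left (-1/(4*z))
  have hf : (fun n : ℕ => (Nat.centralBinom (n + 1) : ℝ) / (2 * ((n : ℝ) + 2)) * z ^ (n + 1))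
      = fun i => -1 / (4 * z) * (Ring.choose (1 / 2) (i + 2) * (-4 * z) ^ (i + 2)) := by
    funext n
    have := coef (n+1)
    rw [mul_pow, show n + 2 = n+1+1 by ring, ← mul_assoc (Ring.choose _ _), this]
    push_cast
    field_simp
    ring
  have hv : (1 + 2 * z - Real.sqrt (1 - 4 * z)) / (4 * z) - 1 = -1 / (4 * z) * (Real.sqrt (1 + -4 * z) - ∑ i ∈ Finset.range 2, Ring.choose (1 / 2 : ℝ) i * (-4 * z) ^ i) := by
    simp [Finset.sum_range_succ, Ring.choose_one_right]
    rw [← sub_eq_add_neg]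
    field_simp
    ring
  rw [hf, hv]
  exact k3

theorem stmt_18 :
    (∀ n : ℕ, 1 ≤ n →
      ∫ x in Set.Ioo (0 : ℝ) 4, x ^ n * (Real.sqrt (4 * x - x ^ 2) / (4 * Real.pi * x))
        = (Nat.choose (2 * n) n : ℝ) / (2 * ((n : ℝ) + 1))) ∧
    (∀ z : ℝ, 0 < |z| → |z| < 1 / 4 →
      HasSum
        (fun n : ℕ =>
          (Nat.choose (2 * (n + 1)) (n + 1) : ℝ) / (2 * ((n : ℝ) + 2)) * z ^ (n + 1))
        ((1 + 2 * z - Real.sqrt (1 - 4 * z)) / (4 * z) - 1)) := by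
  refine ⟨fun n hn => ?_, part2⟩
  obtain ⟨m, rfl⟩ := Nat.exists_eq_add_of_le' hn
  exact part1 m
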